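/- arXiv:math/9306208 — 3 statements merged into one kernel-verified Lean document; each statement's English description precedes it below -/
import Mathlib

section
/- Let $E$ and $F$ be real Banach spaces, $p>1$, $(X,\sigma)$ a finite measure space, and $T$ a linear isometry from $E$ into the Lebesgue–Bochner space $L_p(X;F)$. If $e,f\in E$ satisfy $\|e\|=\|f\|=1$ and have a common tangent functional (there exists $x^*\in E^*$ with $\|x^*\|=1$ and $x^*(e)=x^*(f)=1$), then for $\sigma$-almost all $x\in X$ one has $\|Te(x)\|=\|Tf(x)\|$. -/
open MeasureTheory

/-- The `p`-th power of the norm in a Lebesgue–Bochner space is the integral of the `p`-th power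
of the pointwise norm. -/
theorem integral_norm_rpow_eq_norm_rpow
    {F X : Type*} [NormedAddCommGroup F] [MeasurableSpace X] {σ : Measure X}
    {p : ℝ} (hp : 0 < p) (g : Lp F (ENNReal.ofReal p) σ) :
    ∫ x, ‖g x‖ ^ p ∂σ = ‖g‖ ^ p := by
  have h := (Lp.memLp g).eLpNorm_eq_integral_rpow_norm (by simpa using hp) ENNReal.ofReal_ne_top
  have hI : 0 ≤ ∫ x, ‖g x‖ ^ p ∂σ := integral_nonneg fun x => by positivity
  rw [ENNReal.toReal_ofReal hp.le] at h
  rw [Lp.norm_def, h, ENNReal.toReal_ofReal (by positivity), Real.rpow_inv_rpow hI hp.ne']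

theorem integrable_norm_rpow_Lp
    {F X : Type*} [NormedAddCommGroup F] [MeasurableSpace X] {σ : Measure X}
    {p : ℝ} (hp : 0 < p) (g : Lp F (ENNReal.ofReal p) σ) :
    Integrable (fun x => ‖g x‖ ^ p) σ := by
  have h := (Lp.memLp g).integrable_norm_rpow (by simpa using hp) ENNReal.ofReal_ne_top
  rwa [ENNReal.toReal_ofReal hp.le] at h

theorem norm_add_rpow_le_rpow_midpoint
    {F : Type*} [NormedAddCommGroup F] {p : ℝ} (hp : 0 ≤ p) (u v : F) :
    ‖u + v‖ ^ p ≤ 2 ^ p * ((1 / 2) * ‖u‖ + (1 / 2) * ‖v‖) ^ p := by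
  rw [← Real.mul_rpow (by norm_num) (by positivity)]
  gcongr
  linarith [norm_add_le u v]

theorem norm_add_rpow_le
    {F : Type*} [NormedAddCommGroup F] {p : ℝ} (hp : 1 ≤ p) (u v : F) :
    ‖u + v‖ ^ p ≤ 2 ^ p * ((1 / 2) * ‖u‖ ^ p + (1 / 2) * ‖v‖ ^ p) := by
  refine (norm_add_rpow_le_rpow_midpoint (by linarith) u v).trans ?_
  gcongr
  exact (convexOn_rpow hp).2 (norm_nonneg u) (norm_nonneg v) (by norm_num) (by norm_num)
    (by norm_num)

theorem norm_eq_of_norm_add_rpow_eq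
    {F : Type*} [NormedAddCommGroup F] {p : ℝ} (hp : 1 < p) {u v : F}
    (h : ‖u + v‖ ^ p = 2 ^ p * ((1 / 2) * ‖u‖ ^ p + (1 / 2) * ‖v‖ ^ p)) :
    ‖u‖ = ‖v‖ := by
  by_contra hne
  refine h.not_lt ((norm_add_rpow_le_rpow_midpoint (by linarith) u v).trans_lt ?_)
  gcongr
  exact (strictConvexOn_rpow hp).2 (norm_nonneg u) (norm_nonneg v) hne (by norm_num)
    (by norm_num) (by norm_num)

/-- Equality in the triangle inequality for unit vectors of `L_p(X; F)`, `p > 1`, forces the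
pointwise norms to agree almost everywhere. -/
theorem ae_norm_eq_of_norm_add_eq_two
    {F X : Type*} [NormedAddCommGroup F] [MeasurableSpace X] {σ : Measure X}
    {p : ℝ} (hp : 1 < p) (u v : Lp F (ENNReal.ofReal p) σ)
    (hu : ‖u‖ = 1) (hv : ‖v‖ = 1) (huv : ‖u + v‖ = 2) :
    ∀ᵐ x ∂σ, ‖u x‖ = ‖v x‖ := by
  have hp0 : 0 < p := by linarith
  have hadd : (fun x => ‖(u + v) x‖ ^ p) =ᵐ[σ] fun x => ‖u x + v x‖ ^ p := by
    filter_upwards [Lp.coeFn_add u v] with x hx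
    rw [hx, Pi.add_apply]
  have hiu := (integrable_norm_rpow_Lp hp0 u).const_mul (1 / 2)
  have hiv := (integrable_norm_rpow_Lp hp0 v).const_mul (1 / 2)
  have hR : Integrable
      (fun x => 2 ^ p * ((1 / 2) * ‖u x‖ ^ p + (1 / 2) * ‖v x‖ ^ p)) σ :=
    (hiu.add hiv).const_mul _
  have hL : Integrable (fun x => ‖u x + v x‖ ^ p) σ :=
    (integrable_norm_rpow_Lp hp0 (u + v)).congr hadd
  have hint : ∫ x, ‖u x + v x‖ ^ p ∂σ =
      ∫ x, 2 ^ p * ((1 / 2) * ‖u x‖ ^ p + (1 / 2) * ‖v x‖ ^ p) ∂σ := by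
    rw [← integral_congr_ae hadd, integral_norm_rpow_eq_norm_rpow hp0, integral_const_mul,
      integral_add hiu hiv, integral_const_mul, integral_const_mul,
      integral_norm_rpow_eq_norm_rpow hp0, integral_norm_rpow_eq_norm_rpow hp0, hu, hv, huv,
      Real.one_rpow]
    ring
  have hle := ae_of_all σ fun x => norm_add_rpow_le hp.le (u x) (v x)
  filter_upwards [(integral_eq_iff_of_ae_le hL hR hle).1 hint] with x hx
  exact norm_eq_of_norm_add_rpow_eq hp hx

/-- Lemma 1(i): if unit vectors `e, f` of a Banach space `E` have a common tangent
functional, then any linear isometry `T : E → L_p(X; F)` (with `p > 1`, `σ` finite)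
satisfies `‖Te(x)‖ = ‖Tf(x)‖` for `σ`-a.e. `x`. -/
theorem lemma1_i
    {E F : Type*} [NormedAddCommGroup E] [NormedSpace ℝ E] [CompleteSpace E]
    [NormedAddCommGroup F] [NormedSpace ℝ F] [CompleteSpace F]
    {X : Type*} [MeasurableSpace X] (σ : Measure X) [IsFiniteMeasure σ]
    {p : ℝ} (hp : 1 < p) [Fact (1 ≤ ENNReal.ofReal p)]
    (T : E →ₗᵢ[ℝ] Lp F (ENNReal.ofReal p) σ)
    (e f : E) (he : ‖e‖ = 1) (hf : ‖f‖ = 1)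
    (x' : E →L[ℝ] ℝ) (hx' : ‖x'‖ = 1) (hx'e : x' e = 1) (hx'f : x' f = 1) :
    ∀ᵐ x ∂σ, ‖T e x‖ = ‖T f x‖ := by
  have hef : ‖e + f‖ = 2 := by
    apply le_antisymm
    · linarith [norm_add_le e f]
    · have h := (le_abs_self _).trans (x'.le_opNorm (e + f))
      rw [map_add, hx'e, hx'f, hx', one_mul] at h
      linarith
  refine ae_norm_eq_of_norm_add_eq_two hp (T e) (T f) ?_ ?_ ?_
  · rw [T.norm_map, he]
  · rw [T.norm_map, hf]
  · rw [← map_add, T.norm_map, hef]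
end

section
/- Let $E$ and $F$ be real Banach spaces, $p>1$, $(X,\sigma)$ a finite measure space, and $T$ a linear isometry from $E$ into the Lebesgue–Bochner space $L_p(X;F)$. If $e,f\in E$ satisfy $\|e\|=\|f\|=1$ and have a common tangent functional (there exists $x^*\in E^*$ with $\|x^*\|=1$ and $x^*(e)=x^*(f)=1$), then for $\sigma$-almost all $x\in X$ and every $\alpha>0$ one has $\|Te(x)+\alpha\,Tf(x)\|=\|Te(x)\|+\alpha\|Tf(x)\|$. -/
open MeasureTheory

/-- If `‖a + b‖ = ‖a‖ + ‖b‖`, then the norm is additive on `a` and every nonnegative multiple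
of `b`. -/
theorem norm_add_smul_of_norm_add {F : Type*} [NormedAddCommGroup F] [NormedSpace ℝ F] {a b : F}
    (h : ‖a + b‖ = ‖a‖ + ‖b‖) {α : ℝ} (hα : 0 ≤ α) :
    ‖a + α • b‖ = ‖a‖ + α * ‖b‖ := by
  have hb : ‖α • b‖ = α * ‖b‖ := by rw [norm_smul, Real.norm_of_nonneg hα]
  apply le_antisymm (hb ▸ norm_add_le a (α • b))
  rcases le_total α 1 with h1 | h1
  · have h2 : ‖a + b‖ ≤ ‖a + α • b‖ + (1 - α) * ‖b‖ := by
      have h3 := norm_add_le (a + α • b) ((1 - α) • b)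
      rwa [norm_smul, Real.norm_of_nonneg (by linarith),
        show a + α • b + (1 - α) • b = a + b by module] at h3
    linarith
  · have h2 : α * ‖a + b‖ ≤ ‖a + α • b‖ + (α - 1) * ‖a‖ := by
      have h3 := norm_add_le (a + α • b) ((α - 1) • a)
      rwa [norm_smul, Real.norm_of_nonneg (by linarith),
        show a + α • b + (α - 1) • a = α • (a + b) by module,
        norm_smul, Real.norm_of_nonneg hα] at h3
    rw [h] at h2
    linarith

/-- A function dominated in norm by another one, with no smaller finite `L^p` seminorm for some
`0 < p < ∞`, has almost everywhere the same norm. -/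
theorem ae_norm_eq_of_eLpNorm_le {X F G : Type*} [MeasurableSpace X] [NormedAddCommGroup F]
    [NormedAddCommGroup G] {μ : Measure X} {p : ENNReal} (hp0 : p ≠ 0) (hp : p ≠ ⊤)
    {f : X → F} {g : X → G} (hf : MemLp f p μ) (hg : AEStronglyMeasurable g μ)
    (hfg : ∀ᵐ x ∂μ, ‖f x‖ ≤ ‖g x‖) (hle : eLpNorm g p μ ≤ eLpNorm f p μ) :
    ∀ᵐ x ∂μ, ‖f x‖ = ‖g x‖ := by
  have hpos : 0 < p.toReal := ENNReal.toReal_pos hp0 hp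
  have hfin := (lintegral_rpow_enorm_lt_top_of_eLpNorm_lt_top hp0 hp hf.2).ne
  rw [eLpNorm_eq_lintegral_rpow_enorm_toReal hp0 hp, eLpNorm_eq_lintegral_rpow_enorm_toReal hp0 hp,
    ENNReal.rpow_le_rpow_iff (by positivity)] at hle
  have h := ae_eq_of_ae_le_of_lintegral_le
    (hfg.mono fun x hx ↦ ENNReal.rpow_le_rpow (enorm_le_iff_norm_le.2 hx) hpos.le)
    hfin (hg.enorm.pow_const _) hle
  filter_upwards [h] with x hx
  have h' := ENNReal.rpow_left_injective hpos.ne' hx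
  rw [← toReal_enorm (f x), ← toReal_enorm (g x), h']

/-- Lemma 1(ii): if unit vectors `e, f` of a Banach space `E` have a common tangent
functional, then any linear isometry `T : E → L_p(X; F)` (with `p > 1`, `σ` finite)
satisfies `‖Te(x) + α Tf(x)‖ = ‖Te(x)‖ + α ‖Tf(x)‖` for a.e. `x` and every `α > 0`. -/
theorem lemma1_ii
    {E F : Type*} [NormedAddCommGroup E] [NormedSpace ℝ E] [CompleteSpace E]
    [NormedAddCommGroup F] [NormedSpace ℝ F] [CompleteSpace F]
    {X : Type*} [MeasurableSpace X] (σ : Measure X) [IsFiniteMeasure σ]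
    {p : ℝ} (hp : 1 < p) [Fact (1 ≤ ENNReal.ofReal p)]
    (T : E →ₗᵢ[ℝ] Lp F (ENNReal.ofReal p) σ)
    (e f : E) (he : ‖e‖ = 1) (hf : ‖f‖ = 1)
    (x' : E →L[ℝ] ℝ) (hx' : ‖x'‖ = 1) (hx'e : x' e = 1) (hx'f : x' f = 1) :
    ∀ᵐ x ∂σ, ∀ α : ℝ, 0 < α → ‖T e x + α • T f x‖ = ‖T e x‖ + α * ‖T f x‖ := by
  have hsum : ‖e + f‖ = 2 := by
    apply le_antisymm
    · linarith [norm_add_le e f]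
    · have h := x'.le_opNorm (e + f)
      rw [map_add, hx'e, hx'f, hx', one_mul, Real.norm_of_nonneg (by norm_num)] at h
      linarith
  have hnorm (z : E) : eLpNorm (T z) (ENNReal.ofReal p) σ = ENNReal.ofReal ‖z‖ := by
    rw [← T.norm_map z, Lp.norm_def, ENNReal.ofReal_toReal (Lp.eLpNorm_ne_top _)]
  have hmem (z : E) : MemLp (T z) (ENNReal.ofReal p) σ := Lp.memLp _
  have hle : eLpNorm (fun x ↦ ‖T e x‖ + ‖T f x‖) (ENNReal.ofReal p) σ
      ≤ eLpNorm (T (e + f)) (ENNReal.ofReal p) σ := by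
    calc eLpNorm (fun x ↦ ‖T e x‖ + ‖T f x‖) (ENNReal.ofReal p) σ
        ≤ eLpNorm (fun x ↦ ‖T e x‖) (ENNReal.ofReal p) σ
          + eLpNorm (fun x ↦ ‖T f x‖) (ENNReal.ofReal p) σ :=
          eLpNorm_add_le (hmem e).1.norm (hmem f).1.norm Fact.out
      _ = eLpNorm (T (e + f)) (ENNReal.ofReal p) σ := by
          rw [eLpNorm_norm, eLpNorm_norm, hnorm, hnorm, hnorm, he, hf, hsum,
            ← ENNReal.ofReal_add zero_le_one zero_le_one]
          norm_num
  have hadd : ∀ᵐ x ∂σ, T (e + f) x = T e x + T f x := by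
    rw [map_add]
    exact Lp.coeFn_add _ _
  have heq := ae_norm_eq_of_eLpNorm_le (by simpa using zero_lt_one.trans hp)
    ENNReal.ofReal_ne_top (hmem (e + f)) ((hmem e).1.norm.add (hmem f).1.norm)
    (hadd.mono fun x hx ↦ by
      rw [hx]
      exact (norm_add_le _ _).trans (Real.le_norm_self _)) hle
  filter_upwards [hadd, heq] with x hx hxn α hα
  rw [hx] at hxn
  exact norm_add_smul_of_norm_add (hxn.trans (Real.norm_of_nonneg <|
    add_nonneg (norm_nonneg _) (norm_nonneg _))) hα.le
end

section
/- Let $p>1$, $(X,\sigma)$ and $(Y,\nu)$ finite measure spaces, $F$ a real Banach space, and let $T$ be a linear isometry from $L_1(Y,\nu)$ into the Lebesgue–Bochner space $L_p(X;F)$. If $e,f\in L_1(Y,\nu)$ have disjoint supports (i.e. $e\cdot f=0$ $\nu$-a.e.) and $\|e\|_1=\|f\|_1=1$, then for $\sigma$-almost all $x\in X$, $\|Te(x)\|=\|Tf(x)\|$ and $\|Te(x)+Tf(x)\|=\|Te(x)\|+\|Tf(x)\|$. -/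
open MeasureTheory

theorem MeasureTheory.Lp.integrable_norm_rpow_ofReal {X F : Type*} [MeasurableSpace X]
    {σ : Measure X} [NormedAddCommGroup F] {p : ℝ} (hp : 0 < p)
    (g : Lp F (ENNReal.ofReal p) σ) : Integrable (fun x => ‖g x‖ ^ p) σ := by
  have h := (Lp.memLp g).integrable_norm_rpow (by simpa using hp) ENNReal.ofReal_ne_top
  simpa only [ENNReal.toReal_ofReal hp.le] using h

theorem MeasureTheory.Lp.integral_norm_rpow_ofReal {X F : Type*} [MeasurableSpace X]
    {σ : Measure X} [NormedAddCommGroup F] {p : ℝ} (hp : 0 < p)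
    (g : Lp F (ENNReal.ofReal p) σ) : ∫ x, ‖g x‖ ^ p ∂σ = ‖g‖ ^ p := by
  have hnonneg : 0 ≤ ∫ x, ‖g x‖ ^ p ∂σ := integral_nonneg fun x => by positivity
  rw [Lp.norm_def, (Lp.memLp g).eLpNorm_eq_integral_rpow_norm (by simpa using hp)
    ENNReal.ofReal_ne_top, ENNReal.toReal_ofReal hp.le,
    ENNReal.toReal_ofReal (Real.rpow_nonneg hnonneg _), Real.rpow_inv_rpow hnonneg hp.ne']

theorem MeasureTheory.Lp.norm_add_of_mul_eq_zero {Y : Type*} [MeasurableSpace Y] {ν : Measure Y}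
    (e f : Lp ℝ 1 ν) (hdisj : ∀ᵐ y ∂ν, e y * f y = 0) : ‖e + f‖ = ‖e‖ + ‖f‖ := by
  rw [L1.norm_eq_integral_norm, L1.norm_eq_integral_norm, L1.norm_eq_integral_norm,
    ← integral_add (L1.integrable_coeFn e).norm (L1.integrable_coeFn f).norm]
  refine integral_congr_ae ?_
  filter_upwards [hdisj, Lp.coeFn_add e f] with y hy hadd
  rw [hadd, Pi.add_apply]
  rcases mul_eq_zero.mp hy with h | h <;> simp [h]

theorem Real.div_two_rpow_le_of_le_add {p : ℝ} (hp : 1 < p) {a b c : ℝ} (ha : 0 ≤ a) (hb : 0 ≤ b)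
    (hc : 0 ≤ c) (hcab : c ≤ a + b) : (c / 2) ^ p ≤ (a ^ p + b ^ p) / 2 := by
  have hconv := (convexOn_rpow hp.le).2 (Set.mem_Ici.mpr ha) (Set.mem_Ici.mpr hb)
    (half_pos one_pos).le (half_pos one_pos).le (add_halves 1)
  simp only [smul_eq_mul] at hconv
  calc (c / 2) ^ p ≤ (1 / 2 * a + 1 / 2 * b) ^ p :=
        Real.rpow_le_rpow (by positivity) (by linarith) (by linarith)
    _ ≤ (a ^ p + b ^ p) / 2 := by linarith

theorem Real.eq_and_eq_add_of_div_two_rpow_eq {p : ℝ} (hp : 1 < p) {a b c : ℝ} (ha : 0 ≤ a)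
    (hb : 0 ≤ b) (hc : 0 ≤ c) (hcab : c ≤ a + b) (h : (c / 2) ^ p = (a ^ p + b ^ p) / 2) :
    a = b ∧ c = a + b := by
  have hab : a = b := by
    by_contra hne
    have hconv := (strictConvexOn_rpow hp).2 (Set.mem_Ici.mpr ha) (Set.mem_Ici.mpr hb) hne
      (half_pos one_pos) (half_pos one_pos) (add_halves 1)
    simp only [smul_eq_mul] at hconv
    have hle : (c / 2) ^ p ≤ (1 / 2 * a + 1 / 2 * b) ^ p :=
      Real.rpow_le_rpow (by positivity) (by linarith) (by linarith)
    linarith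
  subst hab
  have hpow : (c / 2) ^ p = a ^ p := by linarith
  have := (Real.rpow_left_inj (by positivity) ha (by linarith)).mp hpow
  exact ⟨rfl, by linarith⟩


/-- If `T : L¹(Y, ν) → L_p(X; F)` is a linear isometry with `p > 1` and `e, f` are
norm-one functions in `L¹(Y, ν)` with disjoint supports, then for a.e. `x`,
`‖Te(x)‖ = ‖Tf(x)‖` and `‖Te(x) + Tf(x)‖ = ‖Te(x)‖ + ‖Tf(x)‖`. -/
theorem isometry_L1_disjoint_support
    {Y : Type*} [MeasurableSpace Y] (ν : Measure Y) [IsFiniteMeasure ν]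
    {F : Type*} [NormedAddCommGroup F] [NormedSpace ℝ F] [CompleteSpace F]
    {X : Type*} [MeasurableSpace X] (σ : Measure X) [IsFiniteMeasure σ]
    {p : ℝ} (hp : 1 < p) [Fact (1 ≤ ENNReal.ofReal p)]
    (T : Lp ℝ 1 ν →ₗᵢ[ℝ] Lp F (ENNReal.ofReal p) σ)
    (e f : Lp ℝ 1 ν) (he : ‖e‖ = 1) (hf : ‖f‖ = 1)
    (hdisj : ∀ᵐ y ∂ν, e y * f y = 0) :
    ∀ᵐ x ∂σ, ‖T e x‖ = ‖T f x‖ ∧ ‖T e x + T f x‖ = ‖T e x‖ + ‖T f x‖ := by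
  have hp0 : 0 < p := by linarith
  have hsum : ‖T e + T f‖ = 2 := by
    rw [← map_add, T.norm_map, Lp.norm_add_of_mul_eq_zero e f hdisj, he, hf]
    norm_num
  have hbound : ∀ x, (‖T e x + T f x‖ / 2) ^ p ≤ (‖T e x‖ ^ p + ‖T f x‖ ^ p) / 2 := fun x =>
    Real.div_two_rpow_le_of_le_add hp (norm_nonneg _) (norm_nonneg _) (norm_nonneg _)
      (norm_add_le _ _)
  have hcongr : (fun x => ‖(T e + T f) x‖ ^ p / 2 ^ p) =ᵐ[σ]
      fun x => (‖T e x + T f x‖ / 2) ^ p := by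
    filter_upwards [Lp.coeFn_add (T e) (T f)] with x hx
    rw [hx, Pi.add_apply, Real.div_rpow (norm_nonneg _) zero_le_two]
  have hintE := Lp.integrable_norm_rpow_ofReal hp0 (T e)
  have hintF := Lp.integrable_norm_rpow_ofReal hp0 (T f)
  have hint : Integrable (fun x => (‖T e x + T f x‖ / 2) ^ p) σ :=
    ((Lp.integrable_norm_rpow_ofReal hp0 (T e + T f)).div_const _).congr hcongr
  have hleft : ∫ x, (‖T e x + T f x‖ / 2) ^ p ∂σ = 1 := by
    rw [← integral_congr_ae hcongr, integral_div, Lp.integral_norm_rpow_ofReal hp0, hsum,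
      div_self (by positivity)]
  have hright : ∫ x, (‖T e x‖ ^ p + ‖T f x‖ ^ p) / 2 ∂σ = 1 := by
    rw [integral_div, integral_add hintE hintF, Lp.integral_norm_rpow_ofReal hp0,
      Lp.integral_norm_rpow_ofReal hp0, T.norm_map, T.norm_map, he, hf, Real.one_rpow]
    norm_num
  have heq := (integral_eq_iff_of_ae_le hint ((hintE.add hintF).div_const 2)
    (Filter.Eventually.of_forall hbound)).mp (hleft.trans hright.symm)
  filter_upwards [heq] with x hx
  exact Real.eq_and_eq_add_of_div_two_rpow_eq hp (norm_nonneg _) (norm_nonneg _) (norm_nonneg _)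
    (norm_add_le _ _) hx
end
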